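/- There exist a non-computable g ∈ 2^ω and a family (g_X)_{X ∈ 2^ω} of elements of 2^ω such that: (i) for every X, ¬(g ≤_T g_X); (ii) for all X ≠ Y, g_X and g_Y are Turing incomparable; (iii) for all X ≠ Y, g ≤_T g_X ⊕ g_Y; and (iv) for every X, g_X ≤_T g ⊕ X. -/

import Mathlib

open Cardinal

namespace Muchnik

/-- Oracle partial recursiveness: `f` is partial recursive relative to the oracle `g`. -/
inductive RecursiveIn (g : ℕ → ℕ) : (ℕ →. ℕ) → Prop
  | oracle : RecursiveIn g ↑g
  | zero : RecursiveIn g (pure 0)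
  | succ : RecursiveIn g ↑Nat.succ
  | left : RecursiveIn g ↑fun n : ℕ => n.unpair.1
  | right : RecursiveIn g ↑fun n : ℕ => n.unpair.2
  | pair {f h} : RecursiveIn g f → RecursiveIn g h →
      RecursiveIn g fun n => Nat.pair <$> f n <*> h n
  | comp {f h} : RecursiveIn g f → RecursiveIn g h →
      RecursiveIn g fun n => h n >>= f
  | prec {f h} : RecursiveIn g f → RecursiveIn g h →
      RecursiveIn g (Nat.unpaired fun a n =>
        n.rec (f a) fun y IH => do let i ← IH; h (Nat.pair a (Nat.pair y i)))
  | rfind {f} : RecursiveIn g f →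
      RecursiveIn g fun a => Nat.rfind fun n => (fun m => m = 0) <$> f (Nat.pair a n)

/-- Turing reducibility `f ≤_T g` for elements of Baire space. -/
def TuringLe (f g : ℕ → ℕ) : Prop := RecursiveIn g ↑f

/-- Strict Turing reducibility `f <_T g`. -/
def TuringLt (f g : ℕ → ℕ) : Prop := TuringLe f g ∧ ¬ TuringLe g f

/-- Turing equivalence `f ≡_T g`. -/
def TuringEquiv (f g : ℕ → ℕ) : Prop := TuringLe f g ∧ TuringLe g f

/-- Turing incomparability `f |_T g`. -/
def TuringIncomp (f g : ℕ → ℕ) : Prop := ¬ TuringLe f g ∧ ¬ TuringLe g f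

/-- Muchnik reducibility `A ≤_w B` between mass problems. -/
def MuchnikLe (A B : Set (ℕ → ℕ)) : Prop := ∀ f ∈ B, ∃ g ∈ A, TuringLe g f

/-- Strict Muchnik reducibility `A <_w B`. -/
def MuchnikLt (A B : Set (ℕ → ℕ)) : Prop := MuchnikLe A B ∧ ¬ MuchnikLe B A

/-- Muchnik equivalence `A ≡_w B`. -/
def MuchnikEquiv (A B : Set (ℕ → ℕ)) : Prop := MuchnikLe A B ∧ MuchnikLe B A

/-- The strict Turing upper cone `C'(f) = {g : f <_T g}`. -/
def cone (f : ℕ → ℕ) : Set (ℕ → ℕ) := {g | TuringLt f g}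

/-- The recursive join `f ⊕ g`: `(f ⊕ g)(2x) = f(x)` and `(f ⊕ g)(2x+1) = g(x)`. -/
def join (f g : ℕ → ℕ) : ℕ → ℕ := fun n => if n % 2 = 0 then f (n / 2) else g (n / 2)

/-- The join `A + B` of mass problems. -/
def joinSet (A B : Set (ℕ → ℕ)) : Set (ℕ → ℕ) := {h | ∃ f ∈ A, ∃ g ∈ B, h = join f g}

/-- Identification of `2^ω` with a subset of Baire space. -/
def ofBool (X : ℕ → Bool) : ℕ → ℕ := fun n => if X n then 1 else 0


/-! ### Basic facts about relative computability -/

theorem rec_of_eq {g : ℕ → ℕ} {f f' : ℕ →. ℕ} (h : RecursiveIn g f) (e : ∀ n, f' n = f n) :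
    RecursiveIn g f' := (funext e : f' = f) ▸ h

theorem TuringLe.trans' {f g h : ℕ → ℕ} (hf : TuringLe f g) (hg : TuringLe g h) :
    TuringLe f h := by
  unfold TuringLe at *
  generalize (f : ℕ →. ℕ) = F at hf
  induction hf with
  | oracle => exact hg
  | zero => exact .zero
  | succ => exact .succ
  | left => exact .left
  | right => exact .right
  | pair _ _ i j => exact .pair i j
  | comp _ _ i j => exact .comp i j
  | prec _ _ i j => exact .prec i j
  | rfind _ i => exact .rfind i

theorem partrec_rec {f : ℕ →. ℕ} (hf : Nat.Partrec f) (g : ℕ → ℕ) : RecursiveIn g f := by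
  induction hf with
  | zero => exact .zero
  | succ => exact .succ
  | left => exact .left
  | right => exact .right
  | pair _ _ i j => exact .pair i j
  | comp _ _ i j => exact .comp i j
  | prec _ _ i j => exact .prec i j
  | rfind _ i => exact .rfind i

theorem computable_le {f : ℕ → ℕ} (hf : Computable f) (g : ℕ → ℕ) : TuringLe f g :=
  partrec_rec (Partrec.nat_iff.1 hf) g

theorem computable_ofBool {g : ℕ → Bool} (hg : Computable g) : Computable (ofBool g) := by
  have : Computable fun n => cond (g n) 1 0 :=
    Computable.cond hg (Computable.const 1) (Computable.const 0)
  refine this.of_eq fun n => ?_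
  cases h : g n <;> simp [ofBool, h]

theorem le_comp {f h g : ℕ → ℕ} (hf : TuringLe f g) (hh : TuringLe h g) :
    TuringLe (fun n => f (h n)) g := by
  have := RecursiveIn.comp hf hh
  refine rec_of_eq this fun n => ?_
  exact (Part.bind_some (h n) (f : ℕ →. ℕ)).symm

theorem le_pair {f h g : ℕ → ℕ} (hf : TuringLe f g) (hh : TuringLe h g) :
    TuringLe (fun n => Nat.pair (f n) (h n)) g := by
  have := RecursiveIn.pair hf hh
  refine rec_of_eq this fun n => ?_
  simp [Seq.seq]

theorem le_comp₂ {F : ℕ → ℕ → ℕ} (hF : Computable₂ F) {f h g : ℕ → ℕ} (hf : TuringLe f g)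
    (hh : TuringLe h g) : TuringLe (fun n => F (f n) (h n)) g := by
  have h1 : Computable fun p : ℕ => F p.unpair.1 p.unpair.2 :=
    hF.comp (Computable.fst.comp Computable.unpair) (Computable.snd.comp Computable.unpair)
  have := le_comp (computable_le h1 g) (le_pair hf hh)
  simpa using this

theorem le_hist (g : ℕ → ℕ) :
    TuringLe (fun n => Encodable.encode ((List.range n).map g)) g := by
  have hS : Computable₂ fun i v : ℕ =>
      Encodable.encode (((Encodable.decode (α := List ℕ) i).getD []) ++ [v]) := by
    apply Computable.encode.comp
    apply Primrec.to_comp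
    apply Primrec.list_concat.comp
    · exact Primrec.option_getD.comp (Primrec.decode.comp Primrec.fst) (Primrec.const _)
    · exact Primrec.snd
  have hu1 : Computable fun p : ℕ => p.unpair.2.unpair.2 :=
    Computable.snd.comp (Computable.unpair.comp (Computable.snd.comp Computable.unpair))
  have hu2 : Computable fun p : ℕ => p.unpair.2.unpair.1 :=
    Computable.fst.comp (Computable.unpair.comp (Computable.snd.comp Computable.unpair))
  have hstep := le_comp₂ hS (computable_le hu1 g)
    (le_comp (f := g) (g := g) RecursiveIn.oracle (computable_le hu2 g))
  have hbase := computable_le (Computable.const (Encodable.encode ([] : List ℕ))) g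
  have hrec := RecursiveIn.prec hbase hstep
  have hp : Computable fun n : ℕ => Nat.pair 0 n :=
    (Primrec₂.natPair.comp (Primrec.const 0) Primrec.id).to_comp
  have := RecursiveIn.comp hrec (computable_le hp g)
  refine rec_of_eq this fun n => ?_
  simp only [PFun.coe_val, Part.bind_eq_bind, Part.bind_some, Nat.unpaired, Nat.unpair_pair]
  induction n with
  | zero => simp
  | succ n ih =>
    simp only [← ih]
    simp [List.range_succ]

/-- Computing from a finite part of the oracle. -/
theorem le_of_list {F : ℕ → List ℕ → ℕ} (hF : Computable₂ F) {u : ℕ → ℕ} (hu : Computable u)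
    (g : ℕ → ℕ) : TuringLe (fun n => F n ((List.range (u n)).map g)) g := by
  have h1 := le_comp (le_hist g) (computable_le hu g)
  have hF' : Computable₂ fun n i : ℕ => F n ((Encodable.decode (α := List ℕ) i).getD []) := by
    apply hF.comp Computable.fst
    exact Computable.option_getD (Computable.decode.comp Computable.snd) (Computable.const _)
  have := le_comp₂ hF' (computable_le Computable.id g) h1
  simpa using this

theorem join_le {f h g : ℕ → ℕ} (hf : TuringLe f g) (hh : TuringLe h g) :
    TuringLe (join f h) g := by
  have hd : Computable fun n : ℕ => n / 2 :=
    (Primrec.nat_div.comp Primrec.id (Primrec.const 2)).to_comp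
  have h1 := le_pair (le_comp hf (computable_le hd g)) (le_comp hh (computable_le hd g))
  have hF : Computable₂ fun n p : ℕ => if n % 2 = 0 then p.unpair.1 else p.unpair.2 := by
    apply Primrec.to_comp
    refine Primrec.ite ?_ ?_ ?_
    · exact Primrec.eq.comp (Primrec.nat_mod.comp Primrec.fst (Primrec.const 2)) (Primrec.const 0)
    · exact Primrec.fst.comp (Primrec.unpair.comp Primrec.snd)
    · exact Primrec.snd.comp (Primrec.unpair.comp Primrec.snd)
  have := le_comp₂ hF (computable_le Computable.id g) h1
  simp only [Nat.unpair_pair, id] at this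
  exact this

/-! ### Codes and continuity -/

/-- Codes for oracle computations. -/
inductive OCode : Type
  | oracle : OCode
  | zero : OCode
  | succ : OCode
  | left : OCode
  | right : OCode
  | pair : OCode → OCode → OCode
  | comp : OCode → OCode → OCode
  | prec : OCode → OCode → OCode
  | rfind : OCode → OCode

/-- A numbering of codes. -/
def OCode.num : OCode → ℕ
  | .oracle => Nat.pair 0 0
  | .zero => Nat.pair 1 0
  | .succ => Nat.pair 2 0
  | .left => Nat.pair 3 0
  | .right => Nat.pair 4 0
  | .pair a b => Nat.pair 5 (Nat.pair a.num b.num)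
  | .comp a b => Nat.pair 6 (Nat.pair a.num b.num)
  | .prec a b => Nat.pair 7 (Nat.pair a.num b.num)
  | .rfind a => Nat.pair 8 a.num

theorem OCode.num_inj : ∀ a b : OCode, a.num = b.num → a = b := by
  intro a
  induction a with
  | oracle | zero | succ | left | right => intro b h; cases b <;> simp_all [OCode.num]
  | pair a b i j | comp a b i j | prec a b i j =>
    intro c h
    cases c <;> simp [OCode.num] at h ⊢
    exact ⟨i _ h.1, j _ h.2⟩
  | rfind a i =>
    intro c h
    cases c <;> simp [OCode.num] at h ⊢
    exact i _ h

instance : Countable OCode := ⟨OCode.num, fun a b h => OCode.num_inj a b h⟩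

/-- Evaluation of codes. -/
def OCode.eval (g : ℕ → ℕ) : OCode → (ℕ →. ℕ)
  | .oracle => ↑g
  | .zero => pure 0
  | .succ => ↑Nat.succ
  | .left => ↑fun n : ℕ => n.unpair.1
  | .right => ↑fun n : ℕ => n.unpair.2
  | .pair f h => fun n => Nat.pair <$> f.eval g n <*> h.eval g n
  | .comp f h => fun n => h.eval g n >>= f.eval g
  | .prec f h => Nat.unpaired fun a n =>
        n.rec (f.eval g a) fun y IH => do let i ← IH; h.eval g (Nat.pair a (Nat.pair y i))
  | .rfind f => fun a => Nat.rfind fun n => (fun m => m = 0) <$> f.eval g (Nat.pair a n)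

theorem exists_code' {g : ℕ → ℕ} {f : ℕ →. ℕ} (h : RecursiveIn g f) :
    ∃ c : OCode, f = c.eval g := by
  induction h with
  | oracle => exact ⟨.oracle, rfl⟩
  | zero => exact ⟨.zero, rfl⟩
  | succ => exact ⟨.succ, rfl⟩
  | left => exact ⟨.left, rfl⟩
  | right => exact ⟨.right, rfl⟩
  | pair _ _ i j =>
    obtain ⟨a, rfl⟩ := i
    obtain ⟨b, rfl⟩ := j
    exact ⟨.pair a b, rfl⟩
  | comp _ _ i j =>
    obtain ⟨a, rfl⟩ := i
    obtain ⟨b, rfl⟩ := j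
    exact ⟨.comp a b, rfl⟩
  | prec _ _ i j =>
    obtain ⟨a, rfl⟩ := i
    obtain ⟨b, rfl⟩ := j
    exact ⟨.prec a b, rfl⟩
  | rfind _ i =>
    obtain ⟨a, rfl⟩ := i
    exact ⟨.rfind a, rfl⟩

theorem exists_code {g f : ℕ → ℕ} (h : TuringLe f g) :
    ∃ c : OCode, (f : ℕ →. ℕ) = c.eval g := exists_code' h

theorem isOpen_eval (c : OCode) : ∀ x y : ℕ, IsOpen {g : ℕ → ℕ | y ∈ c.eval g x} := by
  induction c with
  | oracle =>
    intro x y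
    have : {g : ℕ → ℕ | y ∈ OCode.oracle.eval g x} = (fun g : ℕ → ℕ => g x) ⁻¹' {y} := by
      ext g
      simp [OCode.eval, eq_comm]
    rw [this]
    exact (isOpen_discrete _).preimage (continuous_apply x)
  | zero => intro x y; exact isOpen_const (p := y ∈ (pure 0 : ℕ →. ℕ) x)
  | succ => intro x y; exact isOpen_const (p := y ∈ (↑Nat.succ : ℕ →. ℕ) x)
  | left => intro x y; exact isOpen_const (p := y ∈ (↑fun n : ℕ => n.unpair.1 : ℕ →. ℕ) x)
  | right => intro x y; exact isOpen_const (p := y ∈ (↑fun n : ℕ => n.unpair.2 : ℕ →. ℕ) x)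
  | pair f h i j =>
    intro x y
    have : {g : ℕ → ℕ | y ∈ (OCode.pair f h).eval g x} =
        ⋃ a : ℕ, ⋃ b : ℕ, ({g : ℕ → ℕ | a ∈ f.eval g x} ∩ {g : ℕ → ℕ | b ∈ h.eval g x}) ∩
          {g : ℕ → ℕ | Nat.pair a b = y} := by
      ext g
      simp [OCode.eval, Seq.seq, and_assoc]
    rw [this]
    exact isOpen_iUnion fun a => isOpen_iUnion fun b => ((i x a).inter (j x b)).inter isOpen_const
  | comp f h i j =>
    intro x y
    have : {g : ℕ → ℕ | y ∈ (OCode.comp f h).eval g x} =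
        ⋃ a : ℕ, ({g : ℕ → ℕ | a ∈ h.eval g x} ∩ {g : ℕ → ℕ | y ∈ f.eval g a}) := by
      ext g
      rw [Set.mem_iUnion]
      exact Part.mem_bind_iff
    rw [this]
    exact isOpen_iUnion fun a => (j x a).inter (i a y)
  | prec f h i j =>
    intro x
    simp only [OCode.eval, Nat.unpaired]
    generalize x.unpair.1 = a
    generalize x.unpair.2 = n
    induction n with
    | zero => intro y; exact i a y
    | succ n ih =>
      intro y
      simp only [Part.bind_eq_bind, Part.mem_bind_iff]
      simp only [Set.ofPred_exists, Set.ofPred_and]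
      exact isOpen_iUnion fun b => (ih b).inter (j _ y)
  | rfind f i =>
    intro x y
    have : {g : ℕ → ℕ | y ∈ (OCode.rfind f).eval g x} =
        {g : ℕ → ℕ | 0 ∈ f.eval g (Nat.pair x y)} ∩
        ⋂ m ∈ Set.Iio y, ⋃ v : ℕ, ({g : ℕ → ℕ | v ∈ f.eval g (Nat.pair x m)} ∩
          {g : ℕ → ℕ | v ≠ 0}) := by
      ext g
      change (y ∈ Nat.rfind fun n => (fun m => decide (m = 0)) <$> f.eval g (Nat.pair x n)) ↔ _
      refine Nat.mem_rfind.trans ?_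
      simp
    rw [this]
    refine (i _ _).inter ((Set.finite_Iio y).isOpen_biInter fun m _ =>
      isOpen_iUnion fun v => (i _ _).inter isOpen_const)

theorem continuous_ofBool : Continuous ofBool := by
  refine continuous_pi fun n => ?_
  have : (fun X : ℕ → Bool => ofBool X n) = (fun b : Bool => if b then 1 else 0) ∘ fun X => X n :=
    rfl
  rw [this]
  exact continuous_of_discreteTopology.comp (continuous_apply n)

/-- Open sets of Cantor space contain cylinders. -/
theorem cyl_of_open {U : Set (ℕ → Bool)} (hU : IsOpen U) {g : ℕ → Bool} (hg : g ∈ U) :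
    ∃ N : ℕ, ∀ h : ℕ → Bool, (∀ i < N, h i = g i) → h ∈ U := by
  rw [isOpen_pi_iff] at hU
  obtain ⟨I, u, hu, hI⟩ := hU g hg
  refine ⟨I.sup id + 1, fun h hh => hI fun i hi => ?_⟩
  have : i ≤ I.sup id := Finset.le_sup (f := id) hi
  rw [hh i (by omega)]
  exact (hu i hi).2

theorem open_cyl (g : ℕ → Bool) (N : ℕ) : IsOpen {h : ℕ → Bool | ∀ i < N, h i = g i} := by
  have : {h : ℕ → Bool | ∀ i < N, h i = g i} =
      ⋂ i ∈ Set.Iio N, (fun h : ℕ → Bool => h i) ⁻¹' {g i} := by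
    ext h
    simp
  rw [this]
  exact (Set.finite_Iio N).isOpen_biInter fun i _ =>
    (isOpen_discrete _).preimage (continuous_apply i)

theorem use_principle {c : OCode} {z : ℕ → Bool} {x y : ℕ} (h : y ∈ c.eval (ofBool z) x) :
    ∃ N : ℕ, ∀ z' : ℕ → Bool, (∀ i < N, z' i = z i) → y ∈ c.eval (ofBool z') x :=
  cyl_of_open ((isOpen_eval c x y).preimage continuous_ofBool) h

/-! ### The family -/

/-- Column `k` is active at `n` if there is a marker in `[k, n)`. -/
def Act (g : ℕ → Bool) (k n : ℕ) : Prop := ∃ i < n, k ≤ i ∧ i % 3 = 0 ∧ g i = true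

open Classical in
/-- The part added to the random lane. -/
noncomputable def pert (g Y : ℕ → Bool) (q : ℕ) : Bool :=
  Y q.unpair.1 && (decide (Act g q.unpair.1 q.unpair.2) && g q.unpair.2)

/-- The share of `Y`. -/
noncomputable def Gam (g Y : ℕ → Bool) (q : ℕ) : Bool := xor (g (3 * q + 2)) (pert g Y q)

theorem Act.congr {g g' : ℕ → Bool} {k n : ℕ} (h : ∀ i < n, g' i = g i) (ha : Act g k n) :
    Act g' k n := by
  obtain ⟨i, h1, h2, h3, h4⟩ := ha
  exact ⟨i, h1, h2, h3, by rw [h i h1, h4]⟩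

theorem pert_congr {g g' Y Y' : ℕ → Bool} {q : ℕ}
    (h : ∀ i ≤ q.unpair.2, g' i = g i)
    (hY : Act g q.unpair.1 q.unpair.2 → Y' q.unpair.1 = Y q.unpair.1) :
    pert g' Y' q = pert g Y q := by
  have e : Act g' q.unpair.1 q.unpair.2 ↔ Act g q.unpair.1 q.unpair.2 :=
    ⟨Act.congr fun i hi => (h i hi.le).symm, Act.congr fun i hi => h i hi.le⟩
  unfold pert
  by_cases ha : Act g q.unpair.1 q.unpair.2
  · simp [e, ha, hY ha, h _ le_rfl]
  · simp [e, ha]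

/-- Solve for `g1`. -/
theorem exists_solve (Y z a : ℕ → Bool) :
    ∃ g1 : ℕ → Bool, (∀ p, p % 3 ≠ 2 → g1 p = a p) ∧ Gam g1 Y = z := by
  classical
  -- strings built by recursion on the length
  let F : (p : ℕ) → ((m : ℕ) → m < p → Bool) → Bool := fun p rec =>
    if p % 3 ≠ 2 then a p
    else xor (z (p / 3)) (pert (fun m => if h : m < p then rec m h else false) Y (p / 3))
  let g1 : ℕ → Bool := fun p => Nat.strongRec F p
  have hg : ∀ p, g1 p = F p fun m _ => g1 m := fun p => by
    simp only [g1]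
    rw [Nat.strongRec_eq]
  refine ⟨g1, fun p hp => ?_, ?_⟩
  · rw [hg]; simp [F, hp]
  · funext q
    have h1 : (3 * q + 2) % 3 = 2 := by omega
    have h2 : (3 * q + 2) / 3 = q := by omega
    have h3 : pert (fun m => if m < 3 * q + 2 then g1 m else false) Y q = pert g1 Y q := by
      refine pert_congr (fun i hi => ?_) fun _ => rfl
      have := Nat.unpair_right_le q
      rw [if_pos (by omega)]
    unfold Gam
    rw [hg]
    simp only [F, h1, h2, ne_eq, not_true_eq_false, if_false, dite_eq_ite, h3]
    simp

/-- The key lemma: patterns below `N` can be handled one at a time. -/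
theorem handle (c : OCode) (N : ℕ) (σ : ℕ → Bool) (h : ℕ → Bool) (M : ℕ) (hNM : N ≤ M)
    (hm : ∀ i, N ≤ i → i % 3 = 0 → h i = false) :
    ∃ h' : ℕ → Bool, ∃ M', M ≤ M' ∧ (∀ i < M, h' i = h i) ∧
      (∀ i, N ≤ i → i % 3 = 0 → h' i = false) ∧
      ∀ g : ℕ → Bool, (∀ i < M', g i = h' i) → ∀ Y : ℕ → Bool, (∀ k < N, Y k = σ k) →
        c.eval (ofBool (Gam g Y)) ≠ (ofBool g : ℕ →. ℕ) := by
  by_cases hA : ∃ g1 : ℕ → Bool, (∀ i < M, g1 i = h i) ∧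
      (∀ i, N ≤ i → i % 3 = 0 → g1 i = false) ∧
      ∃ x y, y ∈ c.eval (ofBool (Gam g1 σ)) x ∧ y ≠ ofBool g1 x
  · obtain ⟨g1, e1, e2, x, y, hy, hne⟩ := hA
    obtain ⟨U, hU⟩ := use_principle hy
    refine ⟨g1, M + 3 * U + 2 + x + 1, by omega, e1, e2, fun g hg Y hY heq => ?_⟩
    have : y ∈ c.eval (ofBool (Gam g Y)) x := by
      refine hU _ fun q hq => ?_
      have hq2 := Nat.unpair_right_le q
      unfold Gam
      rw [hg _ (by omega), pert_congr (g := g1) (Y := σ)]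
      · exact fun i hi => hg _ (by omega)
      · rintro ⟨i, -, hki, hi3, hit⟩
        refine hY _ ?_
        by_contra hcon
        rw [e2 i (by omega) hi3] at hit
        cases hit
    rw [heq] at this
    simp only [PFun.coe_val, Part.mem_some_iff] at this
    apply hne
    rw [this]
    simp [ofBool, hg x (by omega)]
  · refine ⟨h, M, le_rfl, fun _ _ => rfl, hm, fun g hg Y hY heq => hA ?_⟩
    obtain ⟨g1, e1, e2⟩ := exists_solve σ (Gam g Y)
      (fun p => if p % 3 = 0 then h p else if p = 3 * M + 1 then !(g p) else g p)
    have key : ∀ p < M, g1 p = h p := by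
      intro p
      induction p using Nat.strong_induction_on with
      | _ p ih =>
        intro hp
        by_cases h2 : p % 3 = 2
        · obtain ⟨q, rfl⟩ : ∃ q, p = 3 * q + 2 := ⟨p / 3, by omega⟩
          have hq2 := Nat.unpair_right_le q
          have h3 : pert g1 σ q = pert g Y q := by
            refine pert_congr (fun i hi => ?_) ?_
            · rw [ih i (by omega) (by omega), hg i (by omega)]
            · rintro ⟨i, hi, hki, hi3, hit⟩
              refine (hY _ ?_).symm
              by_contra hcon
              rw [hg i (by omega), hm i (by omega) hi3] at hit
              cases hit
          have h4 := congrFun e2 q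
          unfold Gam at h4
          rw [h3] at h4
          rw [← hg _ hp]
          exact Bool.xor_left_inj.1 h4
        · rw [e1 p h2]
          by_cases h0 : p % 3 = 0
          · simp [h0]
          · simp only [h0, if_false]
            rw [if_neg (by omega), hg p hp]
    refine ⟨g1, key, fun i hi hi3 => ?_, 3 * M + 1, ofBool g (3 * M + 1), ?_, ?_⟩
    · rw [e1 i (by omega)]
      simp [hi3, hm i hi hi3]
    · rw [e2, heq]
      simp
    · have : g1 (3 * M + 1) = !(g (3 * M + 1)) := by
        rw [e1 _ (by omega)]
        simp
      simp only [ofBool, this]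
      cases g (3 * M + 1) <;> simp

theorem handle_all (c : OCode) (N : ℕ) (h0 : ℕ → Bool) (L : Finset (Fin N → Bool)) :
    ∃ h : ℕ → Bool, ∃ M, N ≤ M ∧ (∀ i < N, h i = h0 i) ∧
      (∀ i, N ≤ i → i % 3 = 0 → h i = false) ∧
      ∀ σ ∈ L, ∀ g : ℕ → Bool, (∀ i < M, g i = h i) → ∀ Y : ℕ → Bool,
        (∀ k : Fin N, Y k = σ k) →
        c.eval (ofBool (Gam g Y)) ≠ (ofBool g : ℕ →. ℕ) := by
  classical
  induction L using Finset.induction_on with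
  | empty =>
    refine ⟨fun i => if i < N then h0 i else false, N, le_rfl, ?_, ?_, by simp⟩
    · intro i hi; simp [hi]
    · intro i hi _; simp [hi]
  | insert σ L _ ih =>
    obtain ⟨h, M, a1, a2, a3, a4⟩ := ih
    obtain ⟨h', M', b1, b2, b3, b4⟩ :=
      handle c N (fun k => if hk : k < N then σ ⟨k, hk⟩ else false) h M a1 a3
    refine ⟨h', M', a1.trans b1, fun i hi => (b2 i (by omega)).trans (a2 i hi), b3, ?_⟩
    intro τ hτ g hg Y hY
    rcases Finset.mem_insert.1 hτ with rfl | hτ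
    · refine b4 g hg Y fun k hk => ?_
      rw [hY ⟨k, hk⟩]
      simp [hk]
    · exact a4 τ hτ g (fun i hi => (hg i (by omega)).trans (b2 i hi)) Y hY

/-- Sets defeating a code. -/
def Dset (c : OCode) : Set (ℕ → Bool) :=
  {g | ∀ Y : ℕ → Bool, c.eval (ofBool (Gam g Y)) ≠ (ofBool g : ℕ →. ℕ)}

theorem dense_of_cyl {D : Set (ℕ → Bool)}
    (h : ∀ (N : ℕ) (h0 : ℕ → Bool), ∃ g ∈ D, ∀ i < N, g i = h0 i) : Dense D := by
  rw [dense_iff_inter_open]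
  rintro U hU ⟨g, hg⟩
  obtain ⟨N, hN⟩ := cyl_of_open hU hg
  obtain ⟨g', h1, h2⟩ := h N g
  exact ⟨g', hN _ h2, h1⟩

theorem dense_Dset (c : OCode) : Dense (interior (Dset c)) := by
  refine dense_of_cyl fun N h0 => ?_
  obtain ⟨h, M, a1, a2, a3, a4⟩ := handle_all c N h0 Finset.univ
  refine ⟨h, ?_, a2⟩
  rw [mem_interior]
  refine ⟨_, ?_, open_cyl h M, fun _ _ => rfl⟩
  intro g hg Y
  exact a4 (fun k => Y k) (Finset.mem_univ _) g hg Y fun _ => rfl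

/-- There is a marker beyond `k`. -/
def Mset (k : ℕ) : Set (ℕ → Bool) := {g | ∃ i, k ≤ i ∧ i % 3 = 0 ∧ g i = true}

theorem open_Mset (k : ℕ) : IsOpen (Mset k) := by
  have : Mset k = ⋃ i : ℕ, ({g : ℕ → Bool | k ≤ i ∧ i % 3 = 0} ∩
      (fun g : ℕ → Bool => g i) ⁻¹' {true}) := by
    ext g
    simp [Mset, and_assoc]
  rw [this]
  exact isOpen_iUnion fun i => isOpen_const.inter
    ((isOpen_discrete _).preimage (continuous_apply i))

theorem dense_Mset (k : ℕ) : Dense (Mset k) := by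
  refine dense_of_cyl fun N h0 => ?_
  refine ⟨fun i => if i < N then h0 i else true, ⟨3 * (N + k), by omega, by omega, ?_⟩, ?_⟩
  · exact if_neg (by omega)
  · intro i hi
    simp [hi]

theorem exists_generic : ∃ g : ℕ → Bool, (∀ k, ∃ i, k ≤ i ∧ i % 3 = 0 ∧ g i = true) ∧
    ∀ (c : OCode) (Y : ℕ → Bool), c.eval (ofBool (Gam g Y)) ≠ (ofBool g : ℕ →. ℕ) := by
  have := dense_iInter_of_isOpen
    (f := fun s : OCode ⊕ ℕ => Sum.elim (fun c => interior (Dset c)) Mset s)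
    (by rintro (c | k); exacts [isOpen_interior, open_Mset k])
    (by rintro (c | k); exacts [dense_Dset c, dense_Mset k])
  obtain ⟨g, hg⟩ := this.nonempty
  rw [Set.mem_iInter] at hg
  exact ⟨g, fun k => hg (.inr k), fun c => interior_subset (hg (.inl c))⟩

/-! ### The two reductions -/

theorem getD_hist (f : ℕ → ℕ) {i u : ℕ} (h : i < u) :
    ((List.range u).map f).getD i 0 = f i := by
  simp [List.getD, h]

theorem join_even (f g : ℕ → ℕ) (n : ℕ) : join f g (2 * n) = f n := by
  simp [join]

theorem join_odd (f g : ℕ → ℕ) (n : ℕ) : join f g (2 * n + 1) = g n := by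
  have h1 : (2 * n + 1) % 2 = 1 := by omega
  have h2 : (2 * n + 1) / 2 = n := by omega
  simp [join, h1, h2]

theorem recover {g : ℕ → Bool} (hI : ∀ k, ∃ i, k ≤ i ∧ i % 3 = 0 ∧ g i = true)
    {X Y : ℕ → Bool} (hXY : X ≠ Y) :
    TuringLe (ofBool g) (join (ofBool (Gam g X)) (ofBool (Gam g Y))) := by
  obtain ⟨k, hk⟩ := Function.ne_iff.1 hXY
  obtain ⟨N, hkN, hN3, hgN⟩ := hI k
  let T : List ℕ := (List.range (N + 1)).map (ofBool g)
  have hp : Primrec fun n : ℕ => 2 * Nat.pair k n :=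
    Primrec.nat_mul.comp (Primrec.const 2) (Primrec₂.natPair.comp (Primrec.const k) Primrec.id)
  have hu : Computable fun n : ℕ => 2 * Nat.pair k n + 2 :=
    (Primrec.nat_add.comp hp (Primrec.const 2)).to_comp
  have hF : Computable₂ fun (n : ℕ) (l : List ℕ) => if n < N + 1 then T.getD n 0 else
      (l.getD (2 * Nat.pair k n) 0 + l.getD (2 * Nat.pair k n + 1) 0) % 2 := by
    apply Primrec.to_comp
    refine Primrec.ite ?_ ?_ ?_
    · exact Primrec.nat_lt.comp Primrec.fst (Primrec.const _)
    · exact (Primrec.list_getD 0).comp (Primrec.const T) Primrec.fst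
    · refine Primrec.nat_mod.comp (Primrec.nat_add.comp ?_ ?_) (Primrec.const 2)
      · exact (Primrec.list_getD 0).comp Primrec.snd (hp.comp Primrec.fst)
      · exact (Primrec.list_getD 0).comp Primrec.snd
          (Primrec.succ.comp (hp.comp Primrec.fst))
  have := le_of_list hF hu (join (ofBool (Gam g X)) (ofBool (Gam g Y)))
  convert this using 1
  funext n
  split_ifs with hn
  · rw [getD_hist _ hn]
  · rw [getD_hist _ (by omega), getD_hist _ (by omega), join_even, join_odd]
    have ha : Act g k n := ⟨N, by omega, hkN, hN3, hgN⟩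
    simp only [ofBool, Gam, pert, Nat.unpair_pair, ha]
    cases g (3 * Nat.pair k n + 2) <;> cases hX : X k <;> cases hY : Y k <;> cases g n <;>
      simp_all

theorem gam_le (g X : ℕ → Bool) :
    TuringLe (ofBool (Gam g X)) (join (ofBool g) (ofBool X)) := by
  classical
  have hu : Computable fun q : ℕ => 6 * q + 5 :=
    (Primrec.nat_add.comp (Primrec.nat_mul.comp (Primrec.const 6) Primrec.id)
      (Primrec.const 5)).to_comp
  have hR : PrimrecRel fun (i : ℕ) (b : ℕ × List ℕ) =>
      b.1 ≤ i ∧ i % 3 = 0 ∧ b.2.getD (2 * i) 0 = 1 := by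
    refine PrimrecPred.and ?_ (PrimrecPred.and ?_ ?_)
    · exact Primrec.nat_le.comp (Primrec.fst.comp Primrec.snd) Primrec.fst
    · exact Primrec.eq.comp (Primrec.nat_mod.comp Primrec.fst (Primrec.const 3)) (Primrec.const 0)
    · exact Primrec.eq.comp ((Primrec.list_getD 0).comp (Primrec.snd.comp Primrec.snd)
        (Primrec.nat_mul.comp (Primrec.const 2) Primrec.fst)) (Primrec.const 1)
  have hA : PrimrecRel fun (n : ℕ) (b : ℕ × List ℕ) =>
      ∃ i < n, b.1 ≤ i ∧ i % 3 = 0 ∧ b.2.getD (2 * i) 0 = 1 :=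
    (hR.exists_mem_list.comp (Primrec.list_range.comp Primrec.fst) Primrec.snd).of_eq (by simp)
  have hfst : Primrec fun p : ℕ × List ℕ => p.1.unpair.1 :=
    Primrec.fst.comp (Primrec.unpair.comp Primrec.fst)
  have hsnd : Primrec fun p : ℕ × List ℕ => p.1.unpair.2 :=
    Primrec.snd.comp (Primrec.unpair.comp Primrec.fst)
  have hF : Computable₂ fun (q : ℕ) (l : List ℕ) =>
      (l.getD (2 * (3 * q + 2)) 0 + (if (∃ i < q.unpair.2, q.unpair.1 ≤ i ∧ i % 3 = 0 ∧
          l.getD (2 * i) 0 = 1) then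
        l.getD (2 * q.unpair.1 + 1) 0 * l.getD (2 * q.unpair.2) 0 else 0)) % 2 := by
    apply Primrec.to_comp
    refine Primrec.nat_mod.comp (Primrec.nat_add.comp ?_ (Primrec.ite ?_ ?_ (Primrec.const 0)))
      (Primrec.const 2)
    · exact (Primrec.list_getD 0).comp Primrec.snd (Primrec.nat_mul.comp (Primrec.const 2)
        (Primrec.nat_add.comp (Primrec.nat_mul.comp (Primrec.const 3) Primrec.fst)
          (Primrec.const 2)))
    · exact hA.comp hsnd (Primrec.pair hfst Primrec.snd)
    · refine Primrec.nat_mul.comp ?_ ?_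
      · exact (Primrec.list_getD 0).comp Primrec.snd
          (Primrec.succ.comp (Primrec.nat_mul.comp (Primrec.const 2) hfst))
      · exact (Primrec.list_getD 0).comp Primrec.snd
          (Primrec.nat_mul.comp (Primrec.const 2) hsnd)
  have := le_of_list hF hu (join (ofBool g) (ofBool X))
  convert this using 1
  funext q
  have h1 := Nat.unpair_right_le q
  have h2 := Nat.unpair_left_le q
  rw [getD_hist _ (by omega), getD_hist _ (by omega), getD_hist _ (by omega), join_even, join_odd,
    join_even]
  have e : (∃ i < q.unpair.2, q.unpair.1 ≤ i ∧ i % 3 = 0 ∧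
      ((List.range (6 * q + 5)).map (join (ofBool g) (ofBool X))).getD (2 * i) 0 = 1) ↔
      Act g q.unpair.1 q.unpair.2 := by
    refine exists_congr fun i => and_congr_right fun hi => ?_
    rw [getD_hist _ (by omega), join_even]
    simp [ofBool]
  simp only [e]
  simp only [ofBool, Gam, pert]
  by_cases ha : Act g q.unpair.1 q.unpair.2
  · simp only [ha, decide_true, if_true, Bool.true_and]
    generalize g (3 * q + 2) = a
    generalize X q.unpair.1 = b
    generalize g q.unpair.2 = d
    cases a <;> cases b <;> cases d <;> simp
  · simp only [ha, decide_false, if_false, Bool.false_and, Bool.and_false]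
    generalize g (3 * q + 2) = a
    cases a <;> simp


/-- There exist a non-computable `g ∈ 2^ω` and a family `(g_X)_{X ∈ 2^ω}` in `2^ω` such
that (i) `¬(g ≤_T g_X)` for all `X`; (ii) `g_X |_T g_Y` for `X ≠ Y`;
(iii) `g ≤_T g_X ⊕ g_Y` for `X ≠ Y`; and (iv) `g_X ≤_T g ⊕ X` for all `X`. -/
theorem exists_noncomputable_family :
    ∃ g : ℕ → Bool, ¬ Computable g ∧
      ∃ G : (ℕ → Bool) → (ℕ → Bool),
        (∀ X : ℕ → Bool, ¬ TuringLe (ofBool g) (ofBool (G X))) ∧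
        (∀ X Y : ℕ → Bool, X ≠ Y → TuringIncomp (ofBool (G X)) (ofBool (G Y))) ∧
        (∀ X Y : ℕ → Bool, X ≠ Y → TuringLe (ofBool g) (join (ofBool (G X)) (ofBool (G Y)))) ∧
        (∀ X : ℕ → Bool, TuringLe (ofBool (G X)) (join (ofBool g) (ofBool X))) := by
  obtain ⟨g, hI, hg⟩ := exists_generic
  have h4 : ∀ X : ℕ → Bool, TuringLe (ofBool (Gam g X)) (join (ofBool g) (ofBool X)) :=
    fun X => gam_le g X
  have h3 : ∀ X Y : ℕ → Bool, X ≠ Y →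
      TuringLe (ofBool g) (join (ofBool (Gam g X)) (ofBool (Gam g Y))) :=
    fun X Y h => recover hI h
  have h1 : ∀ X : ℕ → Bool, ¬ TuringLe (ofBool g) (ofBool (Gam g X)) := by
    intro X h
    obtain ⟨c, hc⟩ := exists_code h
    exact hg c X hc.symm
  have h2 : ∀ X Y : ℕ → Bool, X ≠ Y → ¬ TuringLe (ofBool (Gam g X)) (ofBool (Gam g Y)) :=
    fun X Y hXY h => h1 Y ((h3 X Y hXY).trans' (join_le h .oracle))
  refine ⟨g, fun hc => h1 (fun _ => false) ?_, Gam g, h1,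
    fun X Y h => ⟨h2 X Y h, h2 Y X h.symm⟩, h3, h4⟩
  exact computable_le (computable_ofBool hc) _

end Muchnik
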